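/- Let A be a Hurwitz real n×n matrix and let Ψ be any real n×k matrix of full column rank (k ≤ n). Then there exists a real n×k matrix Φ such that Ψᵀ Φ = I_k and the reduced matrix Ã = Ψᵀ A Φ is Hurwitz. -/

import Mathlib

open Matrix

/-- A real square matrix is Hurwitz if every eigenvalue of it, viewed as a
complex matrix, has strictly negative real part. -/
def IsHurwitz {k : ℕ} (A : Matrix (Fin k) (Fin k) ℝ) : Prop :=
  ∀ μ ∈ spectrum ℂ (A.map (Complex.ofReal)), μ.re < 0

open scoped ComplexOrder

/-- Lyapunov's criterion: a solution `M ≻ 0` of `R M + M Rᴴ ≺ 0` forces the spectrum of `R`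
into the open left half plane. -/
theorem re_neg_of_mem_spectrum_of_lyapunov {m : Type*} [Fintype m] [DecidableEq m]
    {R M : Matrix m m ℂ} (hM : M.PosDef) (hR : (-(R * M + M * Rᴴ)).PosDef)
    {μ : ℂ} (hμ : μ ∈ spectrum ℂ R) : μ.re < 0 := by
  rw [spectrum.mem_iff, Matrix.isUnit_iff_isUnit_det, isUnit_iff_ne_zero, not_not,
    ← exists_vecMul_eq_zero_iff] at hμ
  obtain ⟨w, hw0, hw⟩ := hμ
  have hwR : w ᵥ* R = μ • w := by
    rw [vecMul_sub, sub_eq_zero, Algebra.algebraMap_eq_smul_one, vecMul_smul, vecMul_one] at hw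
    exact hw.symm
  have hv0 : star w ≠ 0 := star_ne_zero.mpr hw0
  have h1 := hM.dotProduct_mulVec_pos hv0
  have h2 := hR.dotProduct_mulVec_pos hv0
  have hRw : Rᴴ *ᵥ star w = star μ • star w := by
    rw [← star_vecMul, hwR, star_smul]
  have key : w ⬝ᵥ ((-(R * M + M * Rᴴ)) *ᵥ star w) = -(μ + star μ) * (w ⬝ᵥ M *ᵥ star w) := by
    rw [neg_mulVec, add_mulVec, ← mulVec_mulVec, ← mulVec_mulVec, hRw, dotProduct_neg,
      dotProduct_add, dotProduct_mulVec, hwR, mulVec_smul, dotProduct_smul, smul_dotProduct]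
    simp only [smul_eq_mul]
    ring
  rw [star_star] at h1 h2
  rw [key] at h2
  rw [Complex.lt_def] at h1 h2
  simp only [Complex.zero_re, Complex.zero_im, Complex.mul_re, Complex.neg_re, Complex.neg_im,
    Complex.add_re, Complex.add_im, Complex.star_def, Complex.conj_re, Complex.conj_im] at h1 h2
  by_contra! h
  nlinarith [h1.1, h2.1, mul_nonneg h h1.1.le]

section L2Operator

open scoped Matrix.Norms.L2Operator
open Filter

theorem posDef_one_sub_mul_conjTranspose_of_norm_lt_one {m : Type*} [Fintype m] [DecidableEq m]
    {C : Matrix m m ℂ} (hC : ‖C‖ < 1) : (1 - C * Cᴴ).PosDef := by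
  refine .of_dotProduct_mulVec_pos (isHermitian_one.sub (isHermitian_mul_conjTranspose_self C)) ?_
  intro x hx
  have hsq (y : m → ℂ) : star y ⬝ᵥ y = ((‖WithLp.toLp 2 y‖ ^ 2 : ℝ) : ℂ) := by
    have := inner_self_eq_norm_sq_to_K (𝕜 := ℂ) (WithLp.toLp 2 y)
    rw [EuclideanSpace.inner_toLp_toLp, dotProduct_comm] at this
    simpa using this
  have hCx : star x ⬝ᵥ (C * Cᴴ) *ᵥ x = star (Cᴴ *ᵥ x) ⬝ᵥ (Cᴴ *ᵥ x) := by
    rw [← mulVec_mulVec, dotProduct_mulVec, star_mulVec, conjTranspose_conjTranspose]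
  rw [sub_mulVec, one_mulVec, dotProduct_sub, hCx, hsq, hsq, ← Complex.ofReal_sub,
    Complex.zero_lt_real, sub_pos]
  have hpos : 0 < ‖WithLp.toLp 2 x‖ := by simpa using hx
  have hle := l2_opNorm_mulVec Cᴴ (WithLp.toLp 2 x)
  rw [l2_opNorm_conjTranspose] at hle
  gcongr
  exact hle.trans_lt (mul_lt_of_lt_one_left hpos hC)

theorem eventually_norm_pow_lt_one_of_spectrum {m : Type*} [Fintype m] [DecidableEq m]
    [Nonempty m] {B : Matrix m m ℂ} (hB : ∀ μ ∈ spectrum ℂ B, ‖μ‖ < 1) :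
    ∀ᶠ N : ℕ in atTop, ‖B ^ N‖ < 1 := by
  have hr : spectralRadius ℂ B < (1 : NNReal) :=
    spectrum.spectralRadius_lt_of_forall_lt B fun μ hμ => by exact_mod_cast hB μ hμ
  filter_upwards [(spectrum.pow_nnnorm_pow_one_div_tendsto_nhds_spectralRadius B).eventually_lt_const
    hr, eventually_gt_atTop 0] with N hN hN0
  have : (‖B ^ N‖₊ : ENNReal) < 1 := by
    by_contra! h
    exact absurd (ENNReal.one_le_rpow h (by positivity : (0 : ℝ) < 1 / N)) (not_le.mpr hN)
  exact_mod_cast this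

end L2Operator

/-- The Cayley transform maps the open left half plane to the open unit disc. -/
theorem norm_lt_one_of_mem_spectrum_cayley {m : Type*} [Fintype m] [DecidableEq m]
    {A B : Matrix m m ℂ} (hA : ∀ μ ∈ spectrum ℂ A, μ.re < 0) (hB : (1 - A) * B = 1 + A)
    {μ : ℂ} (hμ : μ ∈ spectrum ℂ B) : ‖μ‖ < 1 := by
  by_contra! h
  apply hμ
  have hfac : (1 - A) * (algebraMap ℂ _ μ - B) = (μ - 1) • (1 : Matrix m m ℂ) - (μ + 1) • A := by
    rw [mul_sub, hB, Algebra.algebraMap_eq_smul_one, mul_smul_comm, mul_one, smul_sub, sub_smul,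
      add_smul, one_smul, one_smul]
    abel
  have hu : IsUnit ((μ - 1) • (1 : Matrix m m ℂ) - (μ + 1) • A) := by
    by_cases hμ1 : μ + 1 = 0
    · have : μ - 1 ≠ 0 := by
        rw [eq_neg_of_add_eq_zero_left hμ1]; norm_num
      rw [hμ1, zero_smul, sub_zero]
      exact isUnit_one.smul (Units.mk0 _ this)
    · have hval : 0 ≤ ((μ - 1) / (μ + 1)).re := by
        rw [Complex.div_re, ← add_div]
        refine div_nonneg ?_ (Complex.normSq_nonneg _)
        have hsq : 1 ≤ μ.re * μ.re + μ.im * μ.im := by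
          rw [← Complex.normSq_apply, Complex.normSq_eq_norm_sq]; nlinarith
        simp
        nlinarith
      have hnot : IsUnit (algebraMap ℂ (Matrix m m ℂ) ((μ - 1) / (μ + 1)) - A) := by
        by_contra hc
        exact absurd (hA _ hc) (not_lt.mpr hval)
      have := hnot.smul (Units.mk0 _ hμ1)
      rwa [Units.smul_mk0, smul_sub, Algebra.algebraMap_eq_smul_one, smul_smul,
        mul_div_cancel₀ _ hμ1] at this
  rw [← hfac] at hu
  rw [Matrix.isUnit_iff_isUnit_det, det_mul] at hu
  exact (Matrix.isUnit_iff_isUnit_det _).mpr (isUnit_of_mul_isUnit_right hu)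

/-- Partial sums of the Stein series satisfy a telescoping identity. -/
theorem mul_sum_pow_mul_sub_sum_pow {R : Type*} [Ring R] (b c : R) (N : ℕ) :
    b * (∑ i ∈ Finset.range N, b ^ i * c ^ i) * c - ∑ i ∈ Finset.range N, b ^ i * c ^ i =
      b ^ N * c ^ N - 1 := by
  have hsum := Finset.sum_range_sub (fun i => b ^ i * c ^ i) N
  rw [Finset.sum_sub_distrib, pow_zero, pow_zero, mul_one] at hsum
  rw [← hsum, Finset.mul_sum, Finset.sum_mul]
  congr 1
  refine Finset.sum_congr rfl fun i _ => ?_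
  rw [pow_succ' b, pow_succ c]
  simp only [mul_assoc]

/-- Lyapunov's theorem: for a real Hurwitz matrix `A` there is a real `P ≻ 0` with
`A P + P Aᵀ ≺ 0`. -/
theorem IsHurwitz.exists_lyapunov {n : ℕ} {A : Matrix (Fin n) (Fin n) ℝ} (hA : IsHurwitz A) :
    ∃ P : Matrix (Fin n) (Fin n) ℝ, (P.map Complex.ofReal).PosDef ∧
      (-(A.map Complex.ofReal * P.map Complex.ofReal +
        P.map Complex.ofReal * (A.map Complex.ofReal)ᴴ)).PosDef := by
  set A' := A.map Complex.ofReal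
  have hunit' : IsUnit (1 - A') := by
    have h1 : (1 : ℂ) ∉ spectrum ℂ A' := fun h => absurd (hA 1 h) (by norm_num)
    rwa [spectrum.notMem_iff, map_one] at h1
  have hunit : IsUnit (1 - A).det := by
    have : (1 - A') = Complex.ofRealHom.mapMatrix (1 - A) := by
      rw [map_sub, map_one]; rfl
    rw [this, Matrix.isUnit_iff_isUnit_det, ← RingHom.map_det] at hunit'
    simpa using hunit'
  set B : Matrix (Fin n) (Fin n) ℝ := (1 - A)⁻¹ * (1 + A)
  have hBr : (1 - A) * B = 1 + A := by rw [← mul_assoc, mul_nonsing_inv _ hunit, one_mul]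
  set B' := B.map Complex.ofReal
  have hB : (1 - A') * B' = 1 + A' := by
    have := congrArg Complex.ofRealHom.mapMatrix hBr
    rwa [map_mul, map_sub, map_add, map_one] at this
  obtain ⟨N, hN0, hN⟩ : ∃ N : ℕ, 0 < N ∧ (1 - B' ^ N * (B'ᴴ) ^ N).PosDef := by
    rcases isEmpty_or_nonempty (Fin n) with h | h
    · exact ⟨1, one_pos, by rw [Subsingleton.elim (1 - _) (1 : Matrix (Fin n) (Fin n) ℂ)]; exact .one⟩
    · obtain ⟨N, hN, hN0⟩ := ((eventually_norm_pow_lt_one_of_spectrum fun μ hμ =>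
        norm_lt_one_of_mem_spectrum_cayley hA hB hμ).and (Filter.eventually_gt_atTop 0)).exists
      refine ⟨N, hN0, ?_⟩
      rw [← conjTranspose_pow]
      exact posDef_one_sub_mul_conjTranspose_of_norm_lt_one hN
  refine ⟨∑ i ∈ Finset.range N, B ^ i * Bᵀ ^ i, ?_⟩
  have hP : (∑ i ∈ Finset.range N, B ^ i * Bᵀ ^ i).map Complex.ofReal =
      ∑ i ∈ Finset.range N, B' ^ i * B'ᴴ ^ i := by
    have hBt : Complex.ofRealHom.mapMatrix Bᵀ = B'ᴴ := by
      ext i j; simp [B']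
    change Complex.ofRealHom.mapMatrix _ = _
    simp only [map_sum, map_mul, map_pow, hBt]
    rfl
  rw [hP]
  have hstein := mul_sum_pow_mul_sub_sum_pow B' B'ᴴ N
  set P := ∑ i ∈ Finset.range N, B' ^ i * B'ᴴ ^ i with hPdef
  constructor
  · obtain ⟨k, rfl⟩ := Nat.exists_eq_succ_of_ne_zero hN0.ne'
    rw [hPdef, Finset.sum_range_succ', pow_zero, pow_zero, mul_one]
    refine PosDef.posSemidef_add (posSemidef_sum _ fun i _ => ?_) .one
    rw [← conjTranspose_pow]
    exact posSemidef_self_mul_conjTranspose _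
  · have hBH : B'ᴴ * (1 - A')ᴴ = (1 + A')ᴴ := by rw [← conjTranspose_mul, hB]
    have hcong := hN.mul_mul_conjTranspose_same (vecMul_injective_iff_isUnit.mpr hunit')
    have heq : (1 - A') * (1 - B' ^ N * B'ᴴ ^ N) * (1 - A')ᴴ = (2 : ℝ) • -(A' * P + P * A'ᴴ) := by
      calc (1 - A') * (1 - B' ^ N * B'ᴴ ^ N) * (1 - A')ᴴ
          = (1 - A') * P * (1 - A')ᴴ - ((1 - A') * B') * P * (B'ᴴ * (1 - A')ᴴ) := by
            rw [← neg_sub (B' ^ N * B'ᴴ ^ N), ← hstein]; noncomm_ring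
        _ = _ := by
            rw [hB, hBH, conjTranspose_sub, conjTranspose_add, conjTranspose_one, two_smul]
            noncomm_ring
    rw [heq] at hcong
    have := hcong.smul (by norm_num : (0 : ℝ) < 2⁻¹)
    rwa [smul_smul, inv_mul_cancel₀ two_ne_zero, one_smul] at this

theorem exists_right_basis_hurwitz_reduction
    {n k : ℕ} (hkn : k ≤ n) (A : Matrix (Fin n) (Fin n) ℝ)
    (hA : IsHurwitz A)
    (Ψ : Matrix (Fin n) (Fin k) ℝ) (hΨ : Ψ.rank = k) :
    ∃ Φ : Matrix (Fin n) (Fin k) ℝ,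
      Ψᵀ * Φ = 1 ∧ IsHurwitz (Ψᵀ * A * Φ) := by
  obtain ⟨P, hP, hAP⟩ := hA.exists_lyapunov
  set Ψ' := Ψ.map Complex.ofReal
  have hmap {a b c : ℕ} (X : Matrix (Fin a) (Fin b) ℝ) (Y : Matrix (Fin b) (Fin c) ℝ) :
      (X * Y).map Complex.ofReal = X.map Complex.ofReal * Y.map Complex.ofReal :=
    Matrix.map_mul (f := Complex.ofRealHom)
  have hone : (1 : Matrix (Fin k) (Fin k) ℝ).map Complex.ofReal = 1 :=
    map_one Complex.ofRealHom.mapMatrix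
  have hΨt : Ψᵀ.map Complex.ofReal = Ψ'ᴴ := by
    ext i j; simp [Ψ']
  have hgram : IsUnit (Ψᵀ * Ψ).det := by
    rw [← Matrix.isUnit_iff_isUnit_det, ← mulVec_injective_iff_isUnit]
    have htop : LinearMap.range (Ψᵀ * Ψ).mulVecLin = ⊤ := by
      apply Submodule.eq_top_of_finrank_eq
      rw [Module.finrank_fin_fun, ← Matrix.rank, rank_transpose_mul_self, hΨ]
    exact LinearMap.injective_iff_surjective.mpr (LinearMap.range_eq_top.mp htop)
  have hinj : Function.Injective Ψ'.mulVec := by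
    have hleft : ((Ψᵀ * Ψ)⁻¹ * Ψᵀ).map Complex.ofReal * Ψ' = 1 := by
      rw [← hmap, Matrix.mul_assoc, nonsing_inv_mul _ hgram, hone]
    intro x y hxy
    have := congrArg (((Ψᵀ * Ψ)⁻¹ * Ψᵀ).map Complex.ofReal).mulVec hxy
    simpa only [mulVec_mulVec, hleft, one_mulVec] using this
  have hM := hP.conjTranspose_mul_mul_same hinj
  have hMmap : (Ψᵀ * P * Ψ).map Complex.ofReal = Ψ'ᴴ * P.map Complex.ofReal * Ψ' := by
    rw [hmap, hmap, hΨt]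
  have hMunit : IsUnit (Ψᵀ * P * Ψ).det := by
    have := hM.isUnit
    rw [← hMmap, Matrix.isUnit_iff_isUnit_det] at this
    change IsUnit (Complex.ofRealHom.mapMatrix (Ψᵀ * P * Ψ)).det at this
    rw [← RingHom.map_det] at this
    simpa using this
  refine ⟨P * Ψ * (Ψᵀ * P * Ψ)⁻¹, ?_, fun μ hμ =>
    re_neg_of_mem_spectrum_of_lyapunov hM ?_ hμ⟩
  · rw [← Matrix.mul_assoc, ← Matrix.mul_assoc, mul_nonsing_inv _ hMunit]
  · have hred : (Ψᵀ * A * (P * Ψ * (Ψᵀ * P * Ψ)⁻¹)).map Complex.ofReal *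
        (Ψ'ᴴ * P.map Complex.ofReal * Ψ') =
        Ψ'ᴴ * (A.map Complex.ofReal * P.map Complex.ofReal) * Ψ' := by
      have : Ψᵀ * A * (P * Ψ * (Ψᵀ * P * Ψ)⁻¹) * (Ψᵀ * P * Ψ) = Ψᵀ * (A * P) * Ψ := by
        rw [← Matrix.mul_assoc _ _ (Ψᵀ * P * Ψ)⁻¹, nonsing_inv_mul_cancel_right _ _ hMunit]
        simp only [Matrix.mul_assoc]
      rw [← hMmap, ← hmap, this, hmap, hmap, hmap, hΨt]
    have hred' := congrArg conjTranspose hred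
    rw [conjTranspose_mul, hM.isHermitian.eq] at hred'
    rw [hred, hred']
    convert! hAP.conjTranspose_mul_mul_same hinj using 1
    simp only [conjTranspose_mul, conjTranspose_conjTranspose, hP.isHermitian.eq]
    simp only [Matrix.mul_neg, Matrix.neg_mul, Matrix.mul_add, Matrix.add_mul, Matrix.mul_assoc]
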